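/- Let n ≥ 1, let A ⊆ ℝⁿ be a closed set and S ⊆ A a closed set. Assume: (i) every connected component of ℝⁿ ∖ A is convex; (ii) any two points of ℝⁿ ∖ A that lie in the same connected component of ℝⁿ ∖ S lie in the same connected component of ℝⁿ ∖ A. Then for every line L ⊆ ℝⁿ such that L ∩ A has finitely many connected components, every bounded connected component of L ∩ A has nonempty intersection with S. -/

import Mathlib

/-- Around a compact component of a subset `T` of the line, every open set containing the component
contains a segment through any of its points with both endpoints outside `T`. -/
theorem Real.exists_Icc_subset_of_connectedComponentIn_subset {T U : Set ℝ} (hT : IsClosed T)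
    (hU : IsOpen U) {t : ℝ} (ht : t ∈ T) (hb : Bornology.IsBounded (connectedComponentIn T t))
    (hTU : connectedComponentIn T t ⊆ U) :
    ∃ r ∉ T, ∃ s ∉ T, t ∈ Set.Icc r s ∧ Set.Icc r s ⊆ U := by
  set D := connectedComponentIn T t with hD
  have htD : t ∈ D := mem_connectedComponentIn ht
  have hDT : D ⊆ T := connectedComponentIn_subset T t
  have hDpre : IsPreconnected D := isPreconnected_connectedComponentIn
  have hDclosed : IsClosed D :=
    closure_subset_iff_isClosed.1 (hDpre.closure.subset_connectedComponentIn
      (subset_closure htD) (closure_minimal hDT hT))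
  have ha : sInf D ∈ D := hDclosed.csInf_mem ⟨t, htD⟩ hb.bddBelow
  have hb' : sSup D ∈ D := hDclosed.csSup_mem ⟨t, htD⟩ hb.bddAbove
  have hle : ∀ z ∈ D, sInf D ≤ z := fun z hz => csInf_le hb.bddBelow hz
  have hge : ∀ z ∈ D, z ≤ sSup D := fun z hz => le_csSup hb.bddAbove hz
  generalize sInf D = a at ha hle
  generalize sSup D = b at hb' hge
  have hab : Set.Icc a b ⊆ D := hDpre.Icc_subset ha hb'
  obtain ⟨ε, hε, hεU⟩ := Metric.isOpen_iff.1 hU a (hTU ha)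
  obtain ⟨δ, hδ, hδU⟩ := Metric.isOpen_iff.1 hU b (hTU hb')
  have hleft : ∃ r ∉ T, r ∈ Set.Icc (a - ε / 2) a := by
    by_contra! h
    have hsub : Set.Icc (a - ε / 2) a ⊆ D := by
      rw [hD, connectedComponentIn_eq ha]
      exact isPreconnected_Icc.subset_connectedComponentIn
        ⟨by linarith, le_rfl⟩ fun z hz => by_contra fun hzT => h z hzT hz
    linarith [hle _ (hsub ⟨le_rfl, by linarith⟩)]
  have hright : ∃ s ∉ T, s ∈ Set.Icc b (b + δ / 2) := by
    by_contra! h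
    have hsub : Set.Icc b (b + δ / 2) ⊆ D := by
      rw [hD, connectedComponentIn_eq hb']
      exact isPreconnected_Icc.subset_connectedComponentIn
        ⟨le_rfl, by linarith⟩ fun z hz => by_contra fun hzT => h z hzT hz
    linarith [hge _ (hsub ⟨by linarith, le_rfl⟩)]
  obtain ⟨r, hrT, hr⟩ := hleft
  obtain ⟨s, hsT, hs⟩ := hright
  refine ⟨r, hrT, s, hsT, ⟨hr.2.trans (hle t htD), (hge t htD).trans hs.1⟩, fun z hz => ?_⟩
  rcases lt_or_ge z a with hza | hza
  · apply hεU
    rw [Metric.mem_ball, Real.dist_eq, abs_lt]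
    constructor <;> linarith [hr.1, hz.1]
  rcases lt_or_ge b z with hbz | hbz
  · apply hδU
    rw [Metric.mem_ball, Real.dist_eq, abs_lt]
    constructor <;> linarith [hs.2, hz.2]
  · exact hTU (hab ⟨hza, hbz⟩)

/-- The parameters of the points of a line lying in a bounded set form a bounded set. -/
theorem Bornology.IsBounded.preimage_add_smul {E : Type*} [NormedAddCommGroup E] [NormedSpace ℝ E]
    {B : Set E} (hB : Bornology.IsBounded B) (u : E) {v : E} (hv : v ≠ 0) :
    Bornology.IsBounded ((fun t : ℝ => u + t • v) ⁻¹' B) := by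
  obtain ⟨R, hR⟩ := hB.exists_norm_le
  have hv' : 0 < ‖v‖ := norm_pos_iff.2 hv
  refine isBounded_iff_forall_norm_le.2 ⟨(R + ‖u‖) / ‖v‖, fun t ht => ?_⟩
  rw [le_div_iff₀ hv', ← norm_smul]
  calc ‖t • v‖ = ‖(u + t • v) - u‖ := by rw [add_sub_cancel_left]
    _ ≤ ‖u + t • v‖ + ‖u‖ := norm_sub_le _ _
    _ ≤ R + ‖u‖ := by gcongr; exact hR _ ht

theorem stmt3 (n : ℕ) (hn : 1 ≤ n) (A S : Set (Fin n → ℝ))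
    (hA : IsClosed A) (hS : IsClosed S) (hSA : S ⊆ A)
    -- (i) every connected component of the complement of `A` is convex
    (hconv : ∀ x ∉ A, Convex ℝ (connectedComponentIn Aᶜ x))
    -- (ii) two points outside `A` in the same component of `Sᶜ` are in the same component of `Aᶜ`
    (hcomp : ∀ x ∉ A, ∀ y ∉ A, y ∈ connectedComponentIn Sᶜ x → y ∈ connectedComponentIn Aᶜ x)
    (u v : Fin n → ℝ) (hv : v ≠ 0)
    (L : Set (Fin n → ℝ)) (hL : L = Set.range fun t : ℝ => u + t • v)
    -- `L ∩ A` has finitely many connected components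
    (hfin : {C : Set (Fin n → ℝ) | ∃ x ∈ L ∩ A, C = connectedComponentIn (L ∩ A) x}.Finite)
    -- every bounded connected component of `L ∩ A` meets `S`
    (x : Fin n → ℝ) (hx : x ∈ L ∩ A)
    (hbdd : Bornology.IsBounded (connectedComponentIn (L ∩ A) x)) :
    (connectedComponentIn (L ∩ A) x ∩ S).Nonempty := by
  subst hL
  obtain ⟨⟨t, rfl⟩, htA⟩ := hx
  set f : ℝ → Fin n → ℝ := fun t => u + t • v with hf
  have hfc : Continuous f := by fun_prop
  by_contra hne
  rw [Set.not_nonempty_iff_eq_empty, ← Set.disjoint_iff_inter_eq_empty] at hne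
  have hsub : connectedComponentIn (f ⁻¹' A) t ⊆
      f ⁻¹' connectedComponentIn (Set.range f ∩ A) (f t) := by
    rw [← Set.image_subset_iff]
    refine (isPreconnected_connectedComponentIn.image f hfc.continuousOn).subset_connectedComponentIn
      (Set.mem_image_of_mem f (mem_connectedComponentIn htA)) ?_
    rintro _ ⟨z, hz, rfl⟩
    exact ⟨⟨z, rfl⟩, connectedComponentIn_subset (f ⁻¹' A) t hz⟩
  obtain ⟨r, hr, s, hs, hts, hrs⟩ := Real.exists_Icc_subset_of_connectedComponentIn_subset
    (hA.preimage hfc) (hS.isOpen_compl.preimage hfc) htA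
    ((hbdd.preimage_add_smul u hv).subset hsub)
    fun z hz => Set.disjoint_left.1 hne (hsub hz)
  have hle : r ≤ s := hts.1.trans hts.2
  have hsS : f s ∈ connectedComponentIn Sᶜ (f r) :=
    (isPreconnected_Icc.image f hfc.continuousOn).subset_connectedComponentIn
      (Set.mem_image_of_mem f (Set.left_mem_Icc.2 hle)) (Set.image_subset_iff.2 hrs)
      (Set.mem_image_of_mem f (Set.right_mem_Icc.2 hle))
  have hpre : Convex ℝ (f ⁻¹' connectedComponentIn Aᶜ (f r)) := by
    have hline : f = AffineMap.lineMap u (u + v) := by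
      ext z i
      simp [hf, AffineMap.lineMap_apply, add_comm]
    rw [hline] at hr ⊢
    exact (hconv _ hr).affine_preimage (AffineMap.lineMap u (u + v))
  have htA' := hpre.ordConnected.out (mem_connectedComponentIn hr) (hcomp _ hr _ hs hsS) hts
  exact connectedComponentIn_subset _ _ htA' htA
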